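/- Let v : Ω̄×[0,T] → ℝ² be smooth. Then Σ_{l₂=0}^{1} ( Σ_{l₁=0}^{4} ‖ρ₀^{l₂}∂₁^{l₁}D^{l₂}v(t)‖_{L^∞(Ω)} + Σ_{l₁=0}^{2} ‖ρ₀^{l₂}∂₁^{l₁}D^{l₂+1}v(t)‖_{L^∞(Ω)} ) + Σ_{l₁=0}^{2} ‖ρ₀³∂₁^{l₁}D⁴v(t)‖_{L^∞(Ω)} + Σ_{l₂=1}^{4} ‖ρ₀^{l₂}D^{l₂+2}v(t)‖_{L^∞(Ω)} ≤ C E(t,v)^{1/2}. Consequently, if η(x,t) = x + ∫₀ᵗ v(x,s) ds, then ‖Dη(t)‖_{L^∞} ≤ C(1 + t sup_{0≤s≤t}E(s,v)^{1/2}), and Σ_{l₁=2}^{4}‖∂₁^{l₁}η(t)‖_{L^∞} + Σ_{l₁=1}^{2}‖∂₁^{l₁}Dη(t)‖_{L^∞} + Σ_{l₁=1}^{4}‖ρ₀∂₁^{l₁}Dη(t)‖_{L^∞} + Σ_{l₁=0}^{2}‖ρ₀∂₁^{l₁}D²η(t)‖_{L^∞} + Σ_{l₁=0}^{2}‖ρ₀³∂₁^{l₁}D⁴η(t)‖_{L^∞}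 + Σ_{l₂=1}^{4}‖ρ₀^{l₂}D^{l₂+2}η(t)‖_{L^∞} ≤ C t sup_{0≤s≤t} E(s,v)^{1/2}, with C depending only on Ω, C₁, C₂. -/

import Mathlib

open MeasureTheory Real Filter

noncomputable section

/-- The reference domain `Ω = 𝕋 × (0,1)`, realized as the fundamental square `(0,1) × (0,1)`. -/
def Oset : Set (ℝ × ℝ) := Set.Ioo (0:ℝ) 1 ×ˢ Set.Ioo (0:ℝ) 1

/-- The vacuum boundary `Γ = 𝕋 × {0,1}`. -/
def Gset : Set (ℝ × ℝ) := {x : ℝ × ℝ | x.2 = 0 ∨ x.2 = 1}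

/-- Distance to the boundary `Γ`. -/
def distG (x : ℝ × ℝ) : ℝ := min x.2 (1 - x.2)

variable {F : Type*} [NormedAddCommGroup F] [NormedSpace ℝ F]

/-- Horizontal partial derivative `∂₁`. -/
def pd1 (f : ℝ × ℝ → F) : ℝ × ℝ → F := fun x => fderiv ℝ f x (1, 0)

/-- Vertical (normal) partial derivative `∂₂`. -/
def pd2 (f : ℝ × ℝ → F) : ℝ × ℝ → F := fun x => fderiv ℝ f x (0, 1)

/-- Time derivative `∂ₜ`. -/
def pdt (v : ℝ → ℝ × ℝ → F) : ℝ → ℝ × ℝ → F := fun t x => deriv (fun s => v s x) t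

/-- `|Df|²` at a point. -/
def gradSq (f : ℝ × ℝ → F) (x : ℝ × ℝ) : ℝ := ‖pd1 f x‖ ^ 2 + ‖pd2 f x‖ ^ 2

/-- 1-periodicity in the horizontal variable (functions on the torus `𝕋 × (0,1)`). -/
def Per (f : ℝ × ℝ → F) : Prop := ∀ x : ℝ × ℝ, f (x.1 + 1, x.2) = f x

/-- Smoothness. -/
def SmoothFn (f : ℝ × ℝ → F) : Prop := ∀ n : ℕ, ContDiff ℝ n f

/-- Joint smoothness of a time dependent family. -/
def SmoothT (v : ℝ → ℝ × ℝ → F) : Prop :=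
  ∀ n : ℕ, ContDiff ℝ n (fun p : ℝ × (ℝ × ℝ) => v p.1 p.2)

def PerT (v : ℝ → ℝ × ℝ → F) : Prop := ∀ t : ℝ, Per (v t)

/-- Admissible initial depth profile: smooth, periodic, vanishing on `Γ` and
comparable to the distance to the boundary. -/
def IsDensity (C₁ C₂ : ℝ) (ρ₀ : ℝ × ℝ → ℝ) : Prop :=
  SmoothFn ρ₀ ∧ Per ρ₀ ∧ (∀ x ∈ Gset, ρ₀ x = 0) ∧
    ∀ x ∈ Oset, C₁ * distG x ≤ ρ₀ x ∧ ρ₀ x ≤ C₂ * distG x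

/-- The higher-order energy functional `E(t,v)`. -/
def energy (ρ₀ : ℝ × ℝ → ℝ) (v : ℝ → ℝ × ℝ → ℝ × ℝ) (t : ℝ) : ℝ :=
  (∑ l₀ ∈ Finset.range 5, ∫ x in Oset, ρ₀ x * ‖(pdt^[l₀] v) t x‖ ^ 2)
    + (∑ l₀ ∈ Finset.range 4, ∑ l₁ ∈ Finset.range (7 - 2 * l₀),
        ∫ x in Oset, ρ₀ x *
          (gradSq (pd1^[l₁] ((pdt^[l₀] v) t)) x + gradSq (pd1^[l₁ + 1] ((pdt^[l₀] v) t)) x))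
    + ∑ l₀ ∈ Finset.range 4, ∑ l₁ ∈ Finset.range (7 - 2 * l₀),
        ∑ l₂ ∈ Finset.Icc 2 (8 - 2 * l₀ - l₁),
          ∫ x in Oset, ρ₀ x ^ l₂ * ‖(pd1^[l₁] (pd2^[l₂] ((pdt^[l₀] v) t))) x‖ ^ 2

/-- The Lagrangian flow map `η(x,t) = x + ∫₀ᵗ v(x,s) ds`. -/
def flowMap (v : ℝ → ℝ × ℝ → ℝ × ℝ) (t : ℝ) (x : ℝ × ℝ) : ℝ × ℝ :=
  x + ∫ s in (0:ℝ)..t, v s x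

/-- The (squared-sum) Sobolev `H^k(Ω)` norm. -/
def sobolevNorm (k : ℕ) (f : ℝ × ℝ → F) : ℝ :=
  Real.sqrt (∑ θ ∈ Finset.range (k + 1), ∫ x in Oset, ‖iteratedFDeriv ℝ θ f x‖ ^ 2)

/-- `sup_{0 ≤ s ≤ t} E(s,v)^{1/2}`. -/
def supEn (ρ₀ : ℝ × ℝ → ℝ) (v : ℝ → ℝ × ℝ → ℝ × ℝ) (t : ℝ) : ℝ :=
  ⨆ s : Set.Icc (0:ℝ) t, Real.sqrt (energy ρ₀ v ↑s)

/-- Weighted `L²(Ω)` norm `‖ρ₀^p ∂₁^{l₁} D^k f‖_{L²(Ω)}`. -/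
def wL2 (ρ₀ : ℝ × ℝ → ℝ) (p k l₁ : ℕ) (f : ℝ × ℝ → F) : ℝ :=
  Real.sqrt (∫ x in Oset, (ρ₀ x ^ p * ‖iteratedFDeriv ℝ k (pd1^[l₁] f) x‖) ^ 2)

/-- Weighted `L^∞(Ω)` norm `‖ρ₀^p ∂₁^{l₁} D^k f‖_{L^∞(Ω)}`. -/
def wSup (ρ₀ : ℝ × ℝ → ℝ) (p k l₁ : ℕ) (f : ℝ × ℝ → F) : ℝ :=
  ⨆ x : Oset, ρ₀ (x : ℝ × ℝ) ^ p * ‖iteratedFDeriv ℝ k (pd1^[l₁] f) (x : ℝ × ℝ)‖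

def pick (i : Fin 2) (w : ℝ × ℝ) : ℝ := if i = 0 then w.1 else w.2

def evec (k : Fin 2) : ℝ × ℝ := if k = 0 then (1, 0) else (0, 1)

def pdk (k : Fin 2) (f : ℝ × ℝ → ℝ) : ℝ × ℝ → ℝ := fun x => fderiv ℝ f x (evec k)

/-- The cofactor matrix `a` of `Dη`, `a = [[∂₂η², −∂₂η¹], [−∂₁η², ∂₁η¹]]`,
indexed so that `cof η x i k = a_i^k`. -/
def cof (η : ℝ × ℝ → ℝ × ℝ) (x : ℝ × ℝ) (i k : Fin 2) : ℝ :=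
  if i = 0 then
    (if k = 0 then pd2 (fun y => (η y).2) x else -pd1 (fun y => (η y).2) x)
  else
    (if k = 0 then -pd2 (fun y => (η y).1) x else pd1 (fun y => (η y).1) x)

/-- The Jacobian determinant `J = det Dη`. -/
def jac (η : ℝ × ℝ → ℝ × ℝ) (x : ℝ × ℝ) : ℝ :=
  pd1 (fun y => (η y).1) x * pd2 (fun y => (η y).2) x
    - pd2 (fun y => (η y).1) x * pd1 (fun y => (η y).2) x

/-- `b^{kj} = a_l^k a_l^j`. -/
def bmat (η : ℝ × ℝ → ℝ × ℝ) (x : ℝ × ℝ) (k j : Fin 2) : ℝ :=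
  ∑ l : Fin 2, cof η x l k * cof η x l j

/-- `(v,η)` is a (classical) solution of the Lagrangian system
`ρ₀ ∂ₜ v^i + (ρ₀² J⁻² a_i^k),_k = (ρ₀ J⁻² b^{kj} v^i,_j),_k` in `Ω × (0,T]`. -/
def IsLagSol (ρ₀ : ℝ × ℝ → ℝ) (v : ℝ → ℝ × ℝ → ℝ × ℝ) (T : ℝ) : Prop :=
  ∀ t : ℝ, 0 < t → t ≤ T → ∀ x ∈ Oset, ∀ i : Fin 2,
    ρ₀ x * pick i (pdt v t x)
        + ∑ k : Fin 2, pdk k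
            (fun y => ρ₀ y ^ 2 * jac (flowMap v t) y ^ (-2 : ℤ) * cof (flowMap v t) y i k) x
      = ∑ k : Fin 2, pdk k
          (fun y => ρ₀ y * jac (flowMap v t) y ^ (-2 : ℤ) *
            ∑ j : Fin 2, bmat (flowMap v t) y k j * pdk j (fun z => pick i (v t z)) y) x

/-- The a priori assumption: `sup_{0≤t≤T} E(t,v) ≤ M₁`,
`T ∈ (0, 1/(20c₁c₂√M₁ + 10c₁²c₂²M₁)] ∩ (0,1)`, where `c₁, c₂` are the constants of the
embedding inequalities, so that in particular `‖Dv‖_{L^∞} ≤ c₁c₂ E^{1/2}`. -/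
def Apriori (ρ₀ : ℝ × ℝ → ℝ) (v : ℝ → ℝ × ℝ → ℝ × ℝ) (T M₁ c₁ c₂ : ℝ) : Prop :=
  0 < c₁ ∧ 0 < c₂ ∧ 0 ≤ M₁ ∧ 0 < T ∧ T ≤ 1 ∧
    T ≤ 1 / (20 * c₁ * c₂ * Real.sqrt M₁ + 10 * c₁ ^ 2 * c₂ ^ 2 * M₁) ∧
    (∀ t ∈ Set.Icc (0:ℝ) T, energy ρ₀ v t ≤ M₁) ∧
    ∀ t ∈ Set.Icc (0:ℝ) T, ∀ x ∈ Oset,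
      ‖fderiv ℝ (v t) x‖ ≤ c₁ * c₂ * Real.sqrt (energy ρ₀ v t)

/-- Smooth test functions compactly supported in `Ω`. -/
def CinfTest (φ : ℝ × ℝ → ℝ) : Prop :=
  (∀ n : ℕ, ContDiff ℝ n φ) ∧ HasCompactSupport φ ∧ tsupport φ ⊆ Oset

/-- `g` is the weak directional derivative of `u` in direction `e` on `Ω`. -/
def WeakPD (e : ℝ × ℝ) (u g : ℝ × ℝ → ℝ) : Prop :=
  ∀ φ : ℝ × ℝ → ℝ, CinfTest φ →
    ∫ x in Oset, u x * fderiv ℝ φ x e = -∫ x in Oset, g x * φ x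

/-- Membership in the weighted space `H¹_{ρ₀}(Ω)`, with weak gradient `Dw`. -/
def InH1w (ρ₀ : ℝ × ℝ → ℝ) (w : ℝ × ℝ → ℝ) (Dw : ℝ × ℝ → ℝ × ℝ) : Prop :=
  AEStronglyMeasurable w (volume.restrict Oset) ∧
    AEStronglyMeasurable Dw (volume.restrict Oset) ∧
    IntegrableOn (fun x => ρ₀ x * (w x) ^ 2) Oset ∧
    IntegrableOn (fun x => ρ₀ x * ‖Dw x‖ ^ 2) Oset ∧
    WeakPD (1, 0) w (fun x => (Dw x).1) ∧ WeakPD (0, 1) w (fun x => (Dw x).2)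

/-- The bilinear form `B[w,φ]_μ = ∫_Ω ρ₀ (Dw·Dφ + wφ) dx`. -/
def Bform (ρ₀ : ℝ × ℝ → ℝ) (w : ℝ × ℝ → ℝ) (Dw : ℝ × ℝ → ℝ × ℝ)
    (φ : ℝ × ℝ → ℝ) (Dφ : ℝ × ℝ → ℝ × ℝ) : ℝ :=
  ∫ x in Oset, ρ₀ x * ((Dw x).1 * (Dφ x).1 + (Dw x).2 * (Dφ x).2 + w x * φ x)


section OneD

set_option linter.unusedSectionVars false

variable {H : Type*} [NormedAddCommGroup H] [NormedSpace ℝ H] [CompleteSpace H]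

/-- Weighted one-dimensional `L¹` integral. -/
def JJ (G : ℕ → ℝ → H) (q M k : ℕ) : ℝ := ∫ s in (0:ℝ)..1, s ^ q * (1 - s) ^ M * ‖G k s‖

lemma chain_cont {G : ℕ → ℝ → H} (hG : ∀ k s, HasDerivAt (G k) (G (k + 1) s) s) (k : ℕ) :
    Continuous (G k) :=
  continuous_iff_continuousAt.2 fun s => (hG k s).continuousAt

lemma JJ_nonneg (G : ℕ → ℝ → H) (q M k : ℕ) : 0 ≤ JJ G q M k := by
  apply intervalIntegral.integral_nonneg zero_le_one
  intro s hs
  have h1 : 0 ≤ 1 - s := by linarith [hs.2]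
  have h0 := hs.1
  positivity

lemma hardy_pt {G : ℕ → ℝ → H} (hG : ∀ k s, HasDerivAt (G k) (G (k + 1) s) s) (k M : ℕ)
    {s : ℝ} (hs : s ≤ 1) (hs0 : 0 ≤ s) :
    (1 - s) ^ (M + 1) * ‖G k s‖ ≤
      ∫ r in s..1, (M + 1 : ℝ) * (1 - r) ^ M * (‖G k r‖ + ‖G (k + 1) r‖) := by
  have hc := chain_cont hG k
  have hc' := chain_cont hG (k + 1)
  have hd : ∀ r ∈ Set.uIcc s 1, HasDerivAt (fun r => (1 - r) ^ (M + 1) • G k r)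
      ((1 - r) ^ (M + 1) • G (k + 1) r + ((M + 1 : ℝ) * (1 - r) ^ M * (-1)) • G k r) r := by
    intro r _
    have h1 : HasDerivAt (fun r : ℝ => (1 - r) ^ (M + 1)) ((M + 1 : ℝ) * (1 - r) ^ M * (-1)) r := by
      have h0 : HasDerivAt (fun r : ℝ => 1 - r) (-1) r := by
        simpa using (hasDerivAt_id r).const_sub 1
      have := h0.fun_pow (M + 1)
      simpa using this
    exact h1.smul (hG k r)
  have hi := intervalIntegral.integral_eq_sub_of_hasDerivAt hd
    (Continuous.intervalIntegrable (by fun_prop) _ _)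
  have e1 : (1 - s) ^ (M + 1) * ‖G k s‖ = ‖∫ r in s..1, ((1 - r) ^ (M + 1) • G (k + 1) r +
      ((M + 1 : ℝ) * (1 - r) ^ M * (-1)) • G k r)‖ := by
    rw [hi]
    have : 0 ≤ 1 - s := by linarith
    simp [norm_smul, abs_of_nonneg this]
  rw [e1]
  apply intervalIntegral.norm_integral_le_of_norm_le hs
  · filter_upwards with r hr
    have h1 : 0 ≤ 1 - r := by linarith [hr.2]
    have h2 : 1 - r ≤ 1 := by linarith [hr.1]
    refine (norm_add_le _ _).trans ?_
    rw [norm_smul, norm_smul]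
    have e2 : ‖(1 - r) ^ (M + 1)‖ ≤ (M + 1 : ℝ) * (1 - r) ^ M := by
      rw [Real.norm_of_nonneg (by positivity), pow_succ]
      have : 0 ≤ (1 - r) ^ M := by positivity
      have hM : (0:ℝ) ≤ M := by positivity
      nlinarith [mul_nonneg hM this]
    have e3 : ‖(M + 1 : ℝ) * (1 - r) ^ M * (-1)‖ = (M + 1 : ℝ) * (1 - r) ^ M := by
      rw [mul_neg_one, norm_neg, Real.norm_of_nonneg (by positivity)]
    rw [e3]
    have := mul_le_mul_of_nonneg_right e2 (norm_nonneg (G (k + 1) r))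
    linarith
  · exact Continuous.intervalIntegrable (by fun_prop) _ _

lemma hardy_int {G : ℕ → ℝ → H} (hG : ∀ k s, HasDerivAt (G k) (G (k + 1) s) s) (q M k : ℕ) :
    JJ G q (M + 1) k ≤ (M + 1 : ℝ) * (JJ G (q + 1) M k + JJ G (q + 1) M (k + 1)) := by
  have hc := chain_cont hG k
  have hc' := chain_cont hG (k + 1)
  set φ : ℝ → ℝ := fun r => (M + 1 : ℝ) * (1 - r) ^ M * (‖G k r‖ + ‖G (k + 1) r‖) with hφ
  have hφc : Continuous φ := by fun_prop
  set Φ : ℝ → ℝ := fun s => ∫ r in s..1, φ r with hΦ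
  have hΦd : ∀ s, HasDerivAt Φ (-φ s) s := fun s =>
    intervalIntegral.integral_hasDerivAt_left (hφc.intervalIntegrable _ _)
      hφc.stronglyMeasurable.stronglyMeasurableAtFilter hφc.continuousAt
  have hΦc : Continuous Φ := continuous_iff_continuousAt.2 fun s => (hΦd s).continuousAt
  have hΦ0 : ∀ s ∈ Set.Icc (0:ℝ) 1, 0 ≤ Φ s := by
    intro s hs
    apply intervalIntegral.integral_nonneg hs.2
    intro r hr
    have : 0 ≤ 1 - r := by linarith [hr.2]
    simp only [hφ]; positivity
  have step1 : JJ G q (M + 1) k ≤ ∫ s in (0:ℝ)..1, s ^ q * Φ s := by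
    apply intervalIntegral.integral_mono_on zero_le_one
      (Continuous.intervalIntegrable (by fun_prop) _ _)
      (Continuous.intervalIntegrable (by fun_prop) _ _)
    intro s hs
    rw [mul_assoc]
    exact mul_le_mul_of_nonneg_left (hardy_pt hG k M hs.2 hs.1) (pow_nonneg hs.1 _)
  have hd : ∀ s ∈ Set.uIcc (0:ℝ) 1, HasDerivAt (fun s => s ^ (q + 1) * Φ s)
      (((q + 1 : ℝ) * s ^ q) * Φ s + s ^ (q + 1) * (-φ s)) s := by
    intro s _
    have h1 : HasDerivAt (fun r : ℝ => r ^ (q + 1)) ((q + 1 : ℝ) * s ^ q) s := by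
      simpa using hasDerivAt_pow (q + 1) s
    exact h1.mul (hΦd s)
  have hi := intervalIntegral.integral_eq_sub_of_hasDerivAt hd
    (Continuous.intervalIntegrable (by fun_prop) _ _)
  have h1 : Φ 1 = 0 := by simp [hΦ]
  rw [intervalIntegral.integral_add (Continuous.intervalIntegrable (by fun_prop) _ _)
    (Continuous.intervalIntegrable (by fun_prop) _ _), h1] at hi
  simp only [mul_neg, intervalIntegral.integral_neg] at hi
  have step2 : ∫ s in (0:ℝ)..1, s ^ q * Φ s ≤ ∫ s in (0:ℝ)..1, ((q + 1 : ℝ) * s ^ q) * Φ s := by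
    apply intervalIntegral.integral_mono_on zero_le_one
      (Continuous.intervalIntegrable (by fun_prop) _ _)
      (Continuous.intervalIntegrable (by fun_prop) _ _)
    intro s hs
    have := mul_nonneg (pow_nonneg hs.1 q) (hΦ0 s hs)
    have hq : (0:ℝ) ≤ q := by positivity
    nlinarith [mul_nonneg hq this]
  have e : ∫ s in (0:ℝ)..1, s ^ (q + 1) * φ s =
      (M + 1 : ℝ) * (JJ G (q + 1) M k + JJ G (q + 1) M (k + 1)) := by
    unfold JJ
    rw [← intervalIntegral.integral_add (Continuous.intervalIntegrable (by fun_prop) _ _)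
      (Continuous.intervalIntegrable (by fun_prop) _ _), ← intervalIntegral.integral_const_mul]
    congr 1
    ext s
    simp only [hφ]; ring
  rw [← e]
  simp only [zero_pow (Nat.succ_ne_zero q), mul_zero, zero_mul, sub_zero] at hi
  linarith

lemma hardy_iter (M : ℕ) (n : ℕ) : ∃ C : ℝ, 0 ≤ C ∧ ∀ (q k : ℕ) (G : ℕ → ℝ → H),
    (∀ k s, HasDerivAt (G k) (G (k + 1) s) s) →
    JJ G q (M + n) k ≤ C * ∑ j ∈ Finset.range (n + 1), JJ G (q + n) M (k + j) := by
  induction n with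
  | zero => exact ⟨1, zero_le_one, fun q k G hG => by simp⟩
  | succ n ih =>
    obtain ⟨C, hC, h⟩ := ih
    refine ⟨(M + n + 1 : ℝ) * (2 * C), by positivity, fun q k G hG => ?_⟩
    have h0 := hardy_int hG q (M + n) k
    have h1 := h (q + 1) k G hG
    have h2 := h (q + 1) (k + 1) G hG
    have e : q + 1 + n = q + (n + 1) := by ring
    rw [e] at h1 h2
    set S := ∑ j ∈ Finset.range (n + 1 + 1), JJ G (q + (n + 1)) M (k + j) with hS
    have a1 : ∑ j ∈ Finset.range (n + 1), JJ G (q + (n + 1)) M (k + j) ≤ S := by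
      rw [hS, Finset.sum_range_succ _ (n + 1)]
      linarith [JJ_nonneg G (q + (n + 1)) M (k + (n + 1))]
    have a2 : ∑ j ∈ Finset.range (n + 1), JJ G (q + (n + 1)) M (k + 1 + j) ≤ S := by
      rw [hS, Finset.sum_range_succ' _ (n + 1)]
      have : ∀ j, k + 1 + j = k + (j + 1) := fun j => by ring
      simp only [this]
      linarith [JJ_nonneg G (q + (n + 1)) M (k + 0)]
    have b1 := mul_le_mul_of_nonneg_left a1 hC
    have b2 := mul_le_mul_of_nonneg_left a2 hC
    have hM : (0:ℝ) ≤ (M + n + 1 : ℝ) := by positivity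
    push_cast at h0
    calc JJ G q (M + (n + 1)) k ≤ _ := h0
      _ ≤ (M + n + 1 : ℝ) * (2 * C * S) := mul_le_mul_of_nonneg_left (by linarith) hM
      _ = _ := by ring

/-- Left-half pointwise estimate. -/
lemma oneD_left (p m : ℕ) : ∃ C : ℝ, 0 ≤ C ∧ ∀ (G : ℕ → ℝ → H),
    (∀ k s, HasDerivAt (G k) (G (k + 1) s) s) → ∀ x : ℝ, 0 < x → x ≤ 1 / 2 →
    x ^ p * ‖G 0 x‖ ≤ C * ∑ j ∈ Finset.range (m + 2), JJ G (p + m) (p + m) j := by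
  obtain ⟨C, hC, h⟩ := hardy_iter (H := H) (p + m) m
  set M := p + m + m with hM
  refine ⟨2 ^ (M + 1) * ((M + 1 : ℝ) * (2 * C)), by positivity, fun G hG x hx0 hx1 => ?_⟩
  have hc := chain_cont hG 0
  have hc' := chain_cont hG 1
  have h1 := h p 0 G hG
  have h2 := h p 1 G hG
  set S := ∑ j ∈ Finset.range (m + 2), JJ G (p + m) (p + m) j with hS
  have a1 : ∑ j ∈ Finset.range (m + 1), JJ G (p + m) (p + m) (0 + j) ≤ S := by
    rw [hS, Finset.sum_range_succ _ (m + 1)]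
    simp only [zero_add]
    linarith [JJ_nonneg G (p + m) (p + m) (m + 1)]
  have a2 : ∑ j ∈ Finset.range (m + 1), JJ G (p + m) (p + m) (1 + j) ≤ S := by
    rw [hS, Finset.sum_range_succ' _ (m + 1)]
    simp only [add_comm 1]
    linarith [JJ_nonneg G (p + m) (p + m) 0]
  have b1 := mul_le_mul_of_nonneg_left a1 hC
  have b2 := mul_le_mul_of_nonneg_left a2 hC
  have h3 := hardy_pt hG 0 M (s := x) (by linarith) hx0.le
  have h4 : x ^ p * ∫ r in x..1, (M + 1 : ℝ) * (1 - r) ^ M * (‖G 0 r‖ + ‖G (0 + 1) r‖) ≤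
      (M + 1 : ℝ) * (JJ G p M 0 + JJ G p M 1) := by
    rw [← intervalIntegral.integral_const_mul]
    have e : (M + 1 : ℝ) * (JJ G p M 0 + JJ G p M 1) =
        ∫ r in (0:ℝ)..1, r ^ p * ((M + 1 : ℝ) * (1 - r) ^ M * (‖G 0 r‖ + ‖G (0 + 1) r‖)) := by
      unfold JJ
      rw [← intervalIntegral.integral_add (Continuous.intervalIntegrable (by fun_prop) _ _)
        (Continuous.intervalIntegrable (by fun_prop) _ _), ← intervalIntegral.integral_const_mul]
      congr 1
      ext s
      ring_nf
    rw [e, ← intervalIntegral.integral_add_adjacent_intervals (a := 0) (b := x) (c := 1)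
      (Continuous.intervalIntegrable (by fun_prop) _ _)
      (Continuous.intervalIntegrable (by fun_prop) _ _)]
    have pos : 0 ≤ ∫ r in (0:ℝ)..x,
        r ^ p * ((M + 1 : ℝ) * (1 - r) ^ M * (‖G 0 r‖ + ‖G (0 + 1) r‖)) := by
      apply intervalIntegral.integral_nonneg hx0.le
      intro r hr
      have h0 := hr.1
      have : 0 ≤ 1 - r := by linarith [hr.2]
      positivity
    have le : ∫ r in x..1, x ^ p * ((M + 1 : ℝ) * (1 - r) ^ M * (‖G 0 r‖ + ‖G (0 + 1) r‖)) ≤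
        ∫ r in x..1, r ^ p * ((M + 1 : ℝ) * (1 - r) ^ M * (‖G 0 r‖ + ‖G (0 + 1) r‖)) := by
      apply intervalIntegral.integral_mono_on (by linarith)
        (Continuous.intervalIntegrable (by fun_prop) _ _)
        (Continuous.intervalIntegrable (by fun_prop) _ _)
      intro r hr
      have : 0 ≤ 1 - r := by linarith [hr.2]
      have := pow_le_pow_left₀ hx0.le hr.1 p
      gcongr
    linarith
  have h5 : x ^ p * ((1 - x) ^ (M + 1) * ‖G 0 x‖) ≤ (M + 1 : ℝ) * (2 * C * S) := by
    refine (mul_le_mul_of_nonneg_left h3 (by positivity)).trans (h4.trans ?_)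
    exact mul_le_mul_of_nonneg_left (by linarith) (by positivity)
  have h6 : 1 ≤ (2:ℝ) ^ (M + 1) * (1 - x) ^ (M + 1) := by
    rw [← mul_pow]
    exact one_le_pow₀ (by linarith)
  calc x ^ p * ‖G 0 x‖ ≤ (2 ^ (M + 1) * (1 - x) ^ (M + 1)) * (x ^ p * ‖G 0 x‖) :=
        le_mul_of_one_le_left (by positivity) h6
    _ = 2 ^ (M + 1) * (x ^ p * ((1 - x) ^ (M + 1) * ‖G 0 x‖)) := by ring
    _ ≤ 2 ^ (M + 1) * ((M + 1 : ℝ) * (2 * C * S)) := by gcongr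
    _ = _ := by ring

/-- Two-sided pointwise estimate. -/
lemma oneD (p m : ℕ) : ∃ C : ℝ, 0 ≤ C ∧ ∀ (G : ℕ → ℝ → H),
    (∀ k s, HasDerivAt (G k) (G (k + 1) s) s) → ∀ x : ℝ, 0 < x → x < 1 →
    (min x (1 - x)) ^ p * ‖G 0 x‖ ≤ C * ∑ j ∈ Finset.range (m + 2), JJ G (p + m) (p + m) j := by
  obtain ⟨C, hC, h⟩ := oneD_left (H := H) p m
  refine ⟨C, hC, fun G hG x hx0 hx1 => ?_⟩
  rcases le_total x (1 / 2) with hx | hx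
  · rw [min_eq_left (by linarith)]
    exact h G hG x hx0 hx
  · rw [min_eq_right (by linarith)]
    have := h (fun k s => (-1 : ℝ) ^ k • G k (1 - s)) (by
      intro k s
      have h1 : HasDerivAt (fun s : ℝ => 1 - s) (-1) s := by
        simpa using (hasDerivAt_id s).const_sub 1
      have := ((hG k (1 - s)).scomp s h1).const_smul ((-1 : ℝ) ^ k)
      have e : (-1 : ℝ) ^ (k + 1) • G (k + 1) (1 - s) = (-1 : ℝ) ^ k • (-1 : ℝ) • G (k + 1) (1 - s) := by
        rw [smul_smul, pow_succ]
      rw [e]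
      exact this) (1 - x) (by linarith) (by linarith)
    simp only [pow_zero, one_smul, sub_sub_cancel] at this
    refine this.trans (le_of_eq ?_)
    congr 1
    refine Finset.sum_congr rfl fun j _ => ?_
    unfold JJ
    have e := intervalIntegral.integral_comp_sub_left (a := 0) (b := 1)
      (fun s : ℝ => s ^ (p + m) * (1 - s) ^ (p + m) * ‖G j s‖) 1
    simp only [sub_self, sub_zero, sub_sub_cancel] at e
    rw [← e]
    congr 1
    ext s
    simp only [norm_smul, norm_pow, norm_neg, norm_one, one_pow, one_mul]
    ring

end OneD

section PD

variable {H : Type*} [NormedAddCommGroup H] [NormedSpace ℝ H]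

lemma SmoothFn.diff {f : ℝ × ℝ → H} (hf : SmoothFn f) : Differentiable ℝ f :=
  (hf 1).differentiable (by simp)

lemma SmoothFn.fderiv_apply {f : ℝ × ℝ → H} (hf : SmoothFn f) (e : ℝ × ℝ) :
    SmoothFn (fun x => fderiv ℝ f x e) := by
  intro n
  have : ContDiff ℝ n (fderiv ℝ f) := (hf (n + 1)).fderiv_right (by norm_cast)
  exact this.clm_apply contDiff_const

lemma SmoothFn.pd1 {f : ℝ × ℝ → H} (hf : SmoothFn f) : SmoothFn (pd1 f) := hf.fderiv_apply _
lemma SmoothFn.pd2 {f : ℝ × ℝ → H} (hf : SmoothFn f) : SmoothFn (pd2 f) := hf.fderiv_apply _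

lemma SmoothFn.pd1_iter {f : ℝ × ℝ → H} (hf : SmoothFn f) (n : ℕ) : SmoothFn (_root_.pd1^[n] f) := by
  induction n with
  | zero => exact hf
  | succ n ih => rw [Function.iterate_succ_apply']; exact ih.pd1

lemma SmoothFn.pd2_iter {f : ℝ × ℝ → H} (hf : SmoothFn f) (n : ℕ) : SmoothFn (_root_.pd2^[n] f) := by
  induction n with
  | zero => exact hf
  | succ n ih => rw [Function.iterate_succ_apply']; exact ih.pd2

lemma SmoothFn.cont {f : ℝ × ℝ → H} (hf : SmoothFn f) : Continuous f := (hf 0).continuous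

lemma pd_comm {f : ℝ × ℝ → H} (hf : SmoothFn f) : pd2 (pd1 f) = pd1 (pd2 f) := by
  ext x
  have hs : IsSymmSndFDerivAt ℝ f x := by
    apply ((hf 2).contDiffAt).isSymmSndFDerivAt
    simp
  have hd : DifferentiableAt ℝ (fderiv ℝ f) x :=
    (((hf 2).fderiv_right (m := 1) (by norm_num)).differentiable (by simp)) x
  have key : ∀ e e' : ℝ × ℝ, fderiv ℝ (fun y => fderiv ℝ f y e) x e' =
      fderiv ℝ (fderiv ℝ f) x e' e := by
    intro e e'
    rw [fderiv_clm_apply hd (differentiableAt_const e)]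
    simp
  change fderiv ℝ (fun y => fderiv ℝ f y (1, 0)) x (0, 1) =
    fderiv ℝ (fun y => fderiv ℝ f y (0, 1)) x (1, 0)
  rw [key, key]
  exact hs _ _

lemma pd2_pd1_iter {f : ℝ × ℝ → H} (hf : SmoothFn f) (n : ℕ) :
    pd2 (pd1^[n] f) = pd1^[n] (pd2 f) := by
  induction n with
  | zero => rfl
  | succ n ih =>
    rw [Function.iterate_succ_apply', Function.iterate_succ_apply', pd_comm (hf.pd1_iter n), ih]

lemma pd2_iter_pd1_iter {f : ℝ × ℝ → H} (hf : SmoothFn f) (n m : ℕ) :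
    pd2^[m] (pd1^[n] f) = pd1^[n] (pd2^[m] f) := by
  induction m with
  | zero => rfl
  | succ m ih =>
    rw [Function.iterate_succ_apply', Function.iterate_succ_apply', ih,
      pd2_pd1_iter (hf.pd2_iter m)]

lemma pd_mix {f : ℝ × ℝ → H} (hf : SmoothFn f) (i j a b : ℕ) :
    pd1^[i] (pd2^[j] (pd1^[a] (pd2^[b] f))) = pd1^[i + a] (pd2^[j + b] f) := by
  rw [pd2_iter_pd1_iter (hf.pd2_iter b), ← Function.iterate_add_apply,
    ← Function.iterate_add_apply]

lemma fderiv_decomp (f : ℝ × ℝ → H) :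
    fderiv ℝ f = (fun x => ContinuousLinearMap.smulRightL ℝ (ℝ × ℝ) H
        (ContinuousLinearMap.fst ℝ ℝ ℝ) (pd1 f x)) +
      (fun x => ContinuousLinearMap.smulRightL ℝ (ℝ × ℝ) H
        (ContinuousLinearMap.snd ℝ ℝ ℝ) (pd2 f x)) := by
  funext x
  refine ContinuousLinearMap.ext fun w => ?_
  have : w = w.1 • ((1:ℝ), (0:ℝ)) + w.2 • ((0:ℝ), (1:ℝ)) := by ext <;> simp
  simp only [Pi.add_apply, _root_.add_apply,
    ContinuousLinearMap.smulRightL_apply_apply, ContinuousLinearMap.smulRight_apply,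
    ContinuousLinearMap.coe_fst', ContinuousLinearMap.coe_snd', pd1, pd2]
  conv_lhs => rw [this]
  rw [map_add, map_smul, map_smul]

lemma norm_smulRight_fst : ‖ContinuousLinearMap.smulRightL ℝ (ℝ × ℝ) H
        (ContinuousLinearMap.fst ℝ ℝ ℝ)‖ ≤ 1 := by
  refine ContinuousLinearMap.opNorm_le_bound _ zero_le_one fun w => ?_
  rw [ContinuousLinearMap.smulRightL_apply_apply, ContinuousLinearMap.norm_smulRight_apply]
  exact mul_le_mul_of_nonneg_right (ContinuousLinearMap.norm_fst_le ..) (norm_nonneg _)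

lemma norm_smulRight_snd : ‖ContinuousLinearMap.smulRightL ℝ (ℝ × ℝ) H
        (ContinuousLinearMap.snd ℝ ℝ ℝ)‖ ≤ 1 := by
  refine ContinuousLinearMap.opNorm_le_bound _ zero_le_one fun w => ?_
  rw [ContinuousLinearMap.smulRightL_apply_apply, ContinuousLinearMap.norm_smulRight_apply]
  exact mul_le_mul_of_nonneg_right (ContinuousLinearMap.norm_snd_le ..) (norm_nonneg _)

lemma iter_bound (k : ℕ) : ∀ {f : ℝ × ℝ → H}, SmoothFn f → ∀ (x : ℝ × ℝ) (B : ℝ),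
    (∀ i j, i + j = k → ‖pd1^[i] (pd2^[j] f) x‖ ≤ B) → ‖iteratedFDeriv ℝ k f x‖ ≤ 2 ^ k * B := by
  induction k with
  | zero =>
    intro f hf x B h
    simpa using h 0 0 rfl
  | succ k ih =>
    intro f hf x B h
    have h1 := ih hf.pd1 x B (fun i j hij => by
      have e := pd2_iter_pd1_iter hf 1 j
      simp only [Function.iterate_one] at e
      rw [e, ← Function.iterate_succ_apply]
      exact h (i + 1) j (by omega))
    have h2 := ih hf.pd2 x B (fun i j hij => by
      rw [← Function.iterate_succ_apply]
      exact h i (j + 1) (by omega))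
    rw [← norm_iteratedFDeriv_fderiv, fderiv_decomp, iteratedFDeriv_add_apply]
    · refine (norm_add_le _ _).trans ?_
      have a1 := ContinuousLinearMap.norm_iteratedFDeriv_comp_left
        (ContinuousLinearMap.smulRightL ℝ (ℝ × ℝ) H (ContinuousLinearMap.fst ℝ ℝ ℝ))
        ((hf.pd1 k).contDiffAt (x := x)) (le_refl (k : WithTop ℕ∞))
      have a2 := ContinuousLinearMap.norm_iteratedFDeriv_comp_left
        (ContinuousLinearMap.smulRightL ℝ (ℝ × ℝ) H (ContinuousLinearMap.snd ℝ ℝ ℝ))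
        ((hf.pd2 k).contDiffAt (x := x)) (le_refl (k : WithTop ℕ∞))
      have b1 := a1.trans (mul_le_mul_of_nonneg_right norm_smulRight_fst (norm_nonneg _))
      have b2 := a2.trans (mul_le_mul_of_nonneg_right norm_smulRight_snd (norm_nonneg _))
      rw [one_mul] at b1 b2
      have := add_le_add (b1.trans h1) (b2.trans h2)
      refine this.trans (le_of_eq ?_)
      ring
    · exact (ContinuousLinearMap.contDiff _).contDiffAt.comp x (hf.pd1 k).contDiffAt
    · exact (ContinuousLinearMap.contDiff _).contDiffAt.comp x (hf.pd2 k).contDiffAt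

lemma pd1_hasDerivAt {f : ℝ × ℝ → H} (hf : SmoothFn f) (y s : ℝ) :
    HasDerivAt (fun r => f (r, s)) (pd1 f (y, s)) y := by
  have h := (hf.diff (y, s)).hasFDerivAt
  have h2 : HasDerivAt (fun r : ℝ => (r, s)) ((1:ℝ), (0:ℝ)) y :=
    (hasDerivAt_id y).prodMk (hasDerivAt_const y s)
  exact h.comp_hasDerivAt y h2

lemma pd2_hasDerivAt {f : ℝ × ℝ → H} (hf : SmoothFn f) (y s : ℝ) :
    HasDerivAt (fun r => f (y, r)) (pd2 f (y, s)) s := by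
  have h := (hf.diff (y, s)).hasFDerivAt
  have h2 : HasDerivAt (fun r : ℝ => (y, r)) ((0:ℝ), (1:ℝ)) s :=
    (hasDerivAt_const s y).prodMk (hasDerivAt_id s)
  exact h.comp_hasDerivAt s h2

end PD

section TwoD

set_option linter.unusedSectionVars false

variable {H : Type*} [NormedAddCommGroup H] [NormedSpace ℝ H]

lemma Oset_meas : MeasurableSet Oset := measurableSet_Ioo.prod measurableSet_Ioo

lemma Oset_sub : Oset ⊆ Set.Icc (0:ℝ) 1 ×ˢ Set.Icc (0:ℝ) 1 :=
  Set.prod_mono Set.Ioo_subset_Icc_self Set.Ioo_subset_Icc_self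

lemma Oset_int {w : ℝ × ℝ → H} (hw : Continuous w) : IntegrableOn w Oset :=
  (hw.continuousOn.integrableOn_compact (isCompact_Icc.prod isCompact_Icc)).mono_set Oset_sub

lemma Oset_vol : volume Oset = 1 := by
  rw [Oset, Measure.volume_eq_prod, Measure.prod_prod]
  simp

lemma Oset_nonempty : Nonempty Oset := ⟨⟨(1/2, 1/2), by constructor <;> constructor <;> norm_num⟩⟩

lemma Oset_iter {w : ℝ × ℝ → H} (hw : Continuous w) :
    ∫ y in (0:ℝ)..1, ∫ s in (0:ℝ)..1, w (y, s) = ∫ x in Oset, w x := by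
  have h := setIntegral_prod w (μ := volume) (ν := volume) (s := Set.Ioo (0:ℝ) 1)
    (t := Set.Ioo (0:ℝ) 1) (Oset_int hw)
  have e : (volume : Measure (ℝ × ℝ)) = (volume : Measure ℝ).prod volume := rfl
  rw [Oset, e, h]
  simp only [intervalIntegral.integral_of_le zero_le_one, integral_Ioc_eq_integral_Ioo]

lemma Oset_cs {g : ℝ × ℝ → ℝ} (hg : Continuous g) :
    ∫ x in Oset, g x ≤ Real.sqrt (∫ x in Oset, g x ^ 2) := by
  apply Real.le_sqrt_of_sq_le
  set c := ∫ x in Oset, g x with hc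
  have h0 : 0 ≤ ∫ x in Oset, (g x - c) ^ 2 := integral_nonneg fun x => sq_nonneg _
  have e : ∀ x, (g x - c) ^ 2 = g x ^ 2 - (2 * c) * g x + c ^ 2 := fun x => by ring
  simp only [e] at h0
  rw [integral_add (Oset_int (by fun_prop)) (Oset_int continuous_const),
    integral_sub (Oset_int (by fun_prop)) (Oset_int (by fun_prop)), integral_const_mul, ← hc] at h0
  have : ∫ x in Oset, c ^ 2 = c ^ 2 := by
    simp [Measure.real, Oset_vol]
  rw [this] at h0
  nlinarith

variable [CompleteSpace H]

lemma x1_bound {f : ℝ × ℝ → H} (hf : SmoothFn f) {x : ℝ} (hx : x ∈ Set.Icc (0:ℝ) 1) (s : ℝ) :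
    ‖f (x, s)‖ ≤ ∫ y in (0:ℝ)..1, (‖f (y, s)‖ + ‖pd1 f (y, s)‖) := by
  have hc := hf.cont
  have hc' := hf.pd1.cont
  have key : ∀ y ∈ Set.Icc (0:ℝ) 1,
      ‖f (x, s)‖ ≤ ‖f (y, s)‖ + ∫ r in (0:ℝ)..1, ‖pd1 f (r, s)‖ := by
    intro y hy
    have hi : ∫ r in y..x, pd1 f (r, s) = f (x, s) - f (y, s) :=
      intervalIntegral.integral_eq_sub_of_hasDerivAt (fun r _ => pd1_hasDerivAt hf r s)
        (Continuous.intervalIntegrable (by fun_prop) _ _)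
    have h1 : ‖f (x, s) - f (y, s)‖ ≤ ∫ r in (0:ℝ)..1, ‖pd1 f (r, s)‖ := by
      rw [← hi]
      refine (intervalIntegral.norm_integral_le_integral_norm_uIoc).trans ?_
      rw [intervalIntegral.integral_of_le zero_le_one]
      apply setIntegral_mono_set
      · exact (Continuous.integrableOn_Ioc (by fun_prop))
      · exact Eventually.of_forall fun _ => norm_nonneg _
      · apply LE.le.eventuallyLE
        exact Set.Ioc_subset_Ioc (le_min hy.1 hx.1) (max_le hy.2 hx.2)
    have h2 := norm_sub_norm_le (f (x, s)) (f (y, s))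
    linarith
  have h3 : ∫ y in (0:ℝ)..1, ‖f (x, s)‖ ≤
      ∫ y in (0:ℝ)..1, (‖f (y, s)‖ + ∫ r in (0:ℝ)..1, ‖pd1 f (r, s)‖) :=
    intervalIntegral.integral_mono_on zero_le_one (Continuous.intervalIntegrable (by fun_prop) _ _)
      (Continuous.intervalIntegrable (by fun_prop) _ _) key
  rw [intervalIntegral.integral_add (Continuous.intervalIntegrable (by fun_prop) _ _)
      (Continuous.intervalIntegrable (by fun_prop) _ _)] at h3 ⊢
  simpa using h3

lemma slice_bound (p m : ℕ) : ∃ C : ℝ, 0 ≤ C ∧ ∀ (f : ℝ × ℝ → H), SmoothFn f →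
    ∀ s : ℝ, 0 < s → s < 1 →
    (min s (1 - s)) ^ p * ∫ y in (0:ℝ)..1, ‖f (y, s)‖ ≤ C * ∑ j ∈ Finset.range (m + 2),
      ∫ z in Oset, z.2 ^ (p + m) * (1 - z.2) ^ (p + m) * ‖pd2^[j] f z‖ := by
  obtain ⟨C, hC, h⟩ := oneD (H := H) p m
  refine ⟨C, hC, fun f hf s hs0 hs1 => ?_⟩
  have hc := hf.cont
  have hcj : ∀ j, Continuous (pd2^[j] f) := fun j => (hf.pd2_iter j).cont
  have hJc : ∀ j, Continuous
      fun y : ℝ => JJ (fun k r => pd2^[k] f (y, r)) (p + m) (p + m) j := by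
    intro j
    have := hcj j
    unfold JJ
    apply intervalIntegral.continuous_parametric_intervalIntegral_of_continuous'
    simp only [Function.uncurry_def]
    fun_prop
  have pt : ∀ y ∈ Set.Icc (0:ℝ) 1, (min s (1 - s)) ^ p * ‖f (y, s)‖ ≤
      C * ∑ j ∈ Finset.range (m + 2), JJ (fun k r => pd2^[k] f (y, r)) (p + m) (p + m) j := by
    intro y _
    refine h (fun k r => pd2^[k] f (y, r)) (fun k r => ?_) s hs0 hs1
    simp only [Function.iterate_succ_apply']
    exact pd2_hasDerivAt (hf.pd2_iter k) y r
  rw [← intervalIntegral.integral_const_mul]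
  have h1 := intervalIntegral.integral_mono_on (μ := volume) zero_le_one
    (Continuous.intervalIntegrable (by fun_prop) _ _)
    (Continuous.intervalIntegrable (by fun_prop) _ _) pt
  refine h1.trans (le_of_eq ?_)
  rw [intervalIntegral.integral_const_mul, intervalIntegral.integral_finsetSum
    (fun j _ => (hJc j).intervalIntegrable _ _)]
  congr 1
  refine Finset.sum_congr rfl fun j _ => ?_
  have := hcj j
  exact Oset_iter (w := fun z => z.2 ^ (p + m) * (1 - z.2) ^ (p + m) * ‖pd2^[j] f z‖)
    (by fun_prop)

lemma twoD (p m : ℕ) : ∃ C : ℝ, 0 ≤ C ∧ ∀ (f : ℝ × ℝ → H), SmoothFn f →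
    ∀ x ∈ Oset, distG x ^ p * ‖f x‖ ≤ C * ∑ i ∈ Finset.range 2, ∑ j ∈ Finset.range (m + 2),
      ∫ z in Oset, z.2 ^ (p + m) * (1 - z.2) ^ (p + m) * ‖pd1^[i] (pd2^[j] f) z‖ := by
  obtain ⟨C, hC, h⟩ := slice_bound (H := H) p m
  refine ⟨C, hC, fun f hf x hx => ?_⟩
  have hc := hf.cont
  have hc' := hf.pd1.cont
  have h0 := h f hf x.2 hx.2.1 hx.2.2
  have h1 := h (pd1 f) hf.pd1 x.2 hx.2.1 hx.2.2
  have hx1 := x1_bound hf (x := x.1) ⟨hx.1.1.le, hx.1.2.le⟩ x.2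
  rw [intervalIntegral.integral_add (Continuous.intervalIntegrable (by fun_prop) _ _)
      (Continuous.intervalIntegrable (by fun_prop) _ _)] at hx1
  have hd : 0 ≤ distG x := le_min hx.2.1.le (by linarith [hx.2.2])
  rw [Finset.sum_range_succ, Finset.sum_range_one, mul_add]
  have e : ∀ j, pd2^[j] (pd1 f) = pd1^[1] (pd2^[j] f) := fun j => by
    rw [← pd2_iter_pd1_iter hf, Function.iterate_one]
  simp only [e] at h1
  refine (mul_le_mul_of_nonneg_left hx1 (pow_nonneg hd p)).trans ?_
  rw [mul_add]
  exact add_le_add h0 h1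

end TwoD

section Energy

lemma SmoothT.slice {v : ℝ → ℝ × ℝ → ℝ × ℝ} (hv : SmoothT v) (t : ℝ) : SmoothFn (v t) :=
  fun n => (hv n).comp (contDiff_const.prodMk contDiff_id)

lemma SmoothT.pdt {v : ℝ → ℝ × ℝ → ℝ × ℝ} (hv : SmoothT v) : SmoothT (pdt v) := by
  intro n
  have h1 : ContDiff ℝ n (fderiv ℝ (fun p : ℝ × (ℝ × ℝ) => v p.1 p.2)) :=
    (hv (n + 1)).fderiv_right (by norm_cast)
  have e : (fun p : ℝ × (ℝ × ℝ) => _root_.pdt v p.1 p.2) =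
      fun p => fderiv ℝ (fun p : ℝ × (ℝ × ℝ) => v p.1 p.2) p (1, 0) := by
    ext1 p
    have h2 : HasDerivAt (fun s : ℝ => (s, p.2)) ((1:ℝ), (0: ℝ × ℝ)) p.1 :=
      (hasDerivAt_id p.1).prodMk (hasDerivAt_const p.1 p.2)
    have h := (((hv 1).differentiable (by simp)) p).hasFDerivAt
    exact (h.comp_hasDerivAt p.1 h2).deriv
  rw [e]
  exact h1.clm_apply contDiff_const

lemma SmoothT.fderiv_apply {v : ℝ → ℝ × ℝ → ℝ × ℝ} (hv : SmoothT v) (w : ℝ × ℝ) :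
    SmoothT (fun t x => fderiv ℝ (v t) x w) := by
  intro n
  have h1 : ContDiff ℝ n (fderiv ℝ (fun p : ℝ × (ℝ × ℝ) => v p.1 p.2)) :=
    (hv (n + 1)).fderiv_right (by norm_cast)
  have e : (fun p : ℝ × (ℝ × ℝ) => fderiv ℝ (v p.1) p.2 w) =
      fun p => fderiv ℝ (fun p : ℝ × (ℝ × ℝ) => v p.1 p.2) p (0, w) := by
    ext1 p
    have h2 : HasFDerivAt (fun x : ℝ × ℝ => (p.1, x))
        ((0 : ℝ × ℝ →L[ℝ] ℝ).prod (ContinuousLinearMap.id ℝ (ℝ × ℝ))) p.2 :=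
      (hasFDerivAt_const p.1 p.2).prodMk (hasFDerivAt_id p.2)
    have h := (((hv 1).differentiable (by simp)) p).hasFDerivAt
    have h3 := (HasFDerivAt.comp p.2 (f := fun x : ℝ × ℝ => (p.1, x)) h h2).fderiv
    have h4 := congrArg (fun L : ℝ × ℝ →L[ℝ] ℝ × ℝ => L w) h3
    simpa [Function.comp_def] using h4
  rw [e]
  exact h1.clm_apply contDiff_const

lemma SmoothT.pd1 {v : ℝ → ℝ × ℝ → ℝ × ℝ} (hv : SmoothT v) : SmoothT (fun t => pd1 (v t)) :=
  hv.fderiv_apply _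
lemma SmoothT.pd2 {v : ℝ → ℝ × ℝ → ℝ × ℝ} (hv : SmoothT v) : SmoothT (fun t => pd2 (v t)) :=
  hv.fderiv_apply _

lemma SmoothT.pdt_iter {v : ℝ → ℝ × ℝ → ℝ × ℝ} (hv : SmoothT v) (n : ℕ) :
    SmoothT (_root_.pdt^[n] v) := by
  induction n with
  | zero => exact hv
  | succ n ih => rw [Function.iterate_succ_apply']; exact ih.pdt

lemma SmoothT.pd1_iter {v : ℝ → ℝ × ℝ → ℝ × ℝ} (hv : SmoothT v) (n : ℕ) :
    SmoothT (fun t => _root_.pd1^[n] (v t)) := by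
  induction n with
  | zero => exact hv
  | succ n ih => simp only [Function.iterate_succ_apply']; exact ih.pd1

lemma SmoothT.pd2_iter {v : ℝ → ℝ × ℝ → ℝ × ℝ} (hv : SmoothT v) (n : ℕ) :
    SmoothT (fun t => _root_.pd2^[n] (v t)) := by
  induction n with
  | zero => exact hv
  | succ n ih => simp only [Function.iterate_succ_apply']; exact ih.pd2

lemma SmoothT.cont {v : ℝ → ℝ × ℝ → ℝ × ℝ} (hv : SmoothT v) :
    Continuous (fun p : ℝ × (ℝ × ℝ) => v p.1 p.2) := (hv 0).continuous

lemma Oset_param {f : ℝ → ℝ × ℝ → ℝ} (hf : Continuous (fun p : ℝ × (ℝ × ℝ) => f p.1 p.2)) :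
    Continuous fun t => ∫ x in Oset, f t x := by
  have e : ∀ t, ∫ x in Oset, f t x = ∫ y in (0:ℝ)..1, ∫ s in (0:ℝ)..1, f t (y, s) := fun t =>
    (Oset_iter (w := f t) (hf.comp (by fun_prop : Continuous fun x : ℝ × ℝ => (t, x)))).symm
  simp only [e]
  apply intervalIntegral.continuous_parametric_intervalIntegral_of_continuous'
  simp only [Function.uncurry_def]
  apply intervalIntegral.continuous_parametric_intervalIntegral_of_continuous'
    (f := fun (p : ℝ × ℝ) s => f p.1 (p.2, s))
  exact hf.comp (by fun_prop : Continuous fun p : (ℝ × ℝ) × ℝ => (p.1.1, (p.1.2, p.2)))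

lemma energy_cont {ρ₀ : ℝ × ℝ → ℝ} (hρ : Continuous ρ₀) {v : ℝ → ℝ × ℝ → ℝ × ℝ}
    (hv : SmoothT v) : Continuous (energy ρ₀ v) := by
  unfold energy
  refine Continuous.add (Continuous.add ?_ ?_) ?_
  · refine continuous_finsetSum _ fun l₀ _ => Oset_param ?_
    have := (hv.pdt_iter l₀).cont
    fun_prop
  · refine continuous_finsetSum _ fun l₀ _ => continuous_finsetSum _ fun l₁ _ => Oset_param ?_
    have h := (hv.pdt_iter l₀)
    have h1 := (h.pd1_iter l₁).pd1.cont
    have h2 := (h.pd1_iter l₁).pd2.cont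
    have h3 := (h.pd1_iter (l₁ + 1)).pd1.cont
    have h4 := (h.pd1_iter (l₁ + 1)).pd2.cont
    unfold gradSq
    fun_prop
  · refine continuous_finsetSum _ fun l₀ _ => continuous_finsetSum _ fun l₁ _ =>
      continuous_finsetSum _ fun l₂ _ => Oset_param ?_
    have h := (((hv.pdt_iter l₀).pd2_iter l₂).pd1_iter l₁).cont
    fun_prop

end Energy

section Core

variable {C₁ C₂ : ℝ} {ρ₀ : ℝ × ℝ → ℝ} {v : ℝ → ℝ × ℝ → ℝ × ℝ}

lemma distG_pos {x : ℝ × ℝ} (hx : x ∈ Oset) : 0 < distG x :=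
  lt_min hx.2.1 (by linarith [hx.2.2])

lemma rho_nonneg (hC₁ : 0 < C₁) (h : IsDensity C₁ C₂ ρ₀) {x : ℝ × ℝ} (hx : x ∈ Oset) :
    0 ≤ ρ₀ x :=
  (mul_nonneg hC₁.le (distG_pos hx).le).trans (h.2.2.2 x hx).1

lemma en_t1 (h0 : ∀ x ∈ Oset, 0 ≤ ρ₀ x) (l₀ : ℕ) (t : ℝ) :
    0 ≤ ∫ x in Oset, ρ₀ x * ‖(pdt^[l₀] v) t x‖ ^ 2 :=
  setIntegral_nonneg Oset_meas fun x hx => mul_nonneg (h0 x hx) (by positivity)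

lemma en_t2 (h0 : ∀ x ∈ Oset, 0 ≤ ρ₀ x) (l₀ l₁ : ℕ) (t : ℝ) :
    0 ≤ ∫ x in Oset, ρ₀ x *
          (gradSq (pd1^[l₁] ((pdt^[l₀] v) t)) x + gradSq (pd1^[l₁ + 1] ((pdt^[l₀] v) t)) x) :=
  setIntegral_nonneg Oset_meas fun x hx => mul_nonneg (h0 x hx) (by unfold gradSq; positivity)

lemma en_t3 (h0 : ∀ x ∈ Oset, 0 ≤ ρ₀ x) (l₀ l₁ l₂ : ℕ) (t : ℝ) :
    0 ≤ ∫ x in Oset, ρ₀ x ^ l₂ * ‖(pd1^[l₁] (pd2^[l₂] ((pdt^[l₀] v) t))) x‖ ^ 2 :=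
  setIntegral_nonneg Oset_meas fun x hx => mul_nonneg (pow_nonneg (h0 x hx) _) (by positivity)

lemma energy_parts (h0 : ∀ x ∈ Oset, 0 ≤ ρ₀ x) (t : ℝ) :
    (∫ x in Oset, ρ₀ x * ‖v t x‖ ^ 2 ≤ energy ρ₀ v t) ∧
    (∀ l ≤ 6, ∫ x in Oset, ρ₀ x * (gradSq (pd1^[l] (v t)) x + gradSq (pd1^[l + 1] (v t)) x)
      ≤ energy ρ₀ v t) ∧
    (∀ a b, 2 ≤ b → a + b ≤ 8 →
      ∫ x in Oset, ρ₀ x ^ b * ‖pd1^[a] (pd2^[b] (v t)) x‖ ^ 2 ≤ energy ρ₀ v t) := by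
  have s1 : 0 ≤ (∑ l₀ ∈ Finset.range 5, ∫ x in Oset, ρ₀ x * ‖(pdt^[l₀] v) t x‖ ^ 2) :=
    Finset.sum_nonneg fun l₀ _ => en_t1 h0 l₀ t
  have s2' : ∀ l₀ ∈ Finset.range 4, 0 ≤ ∑ l₁ ∈ Finset.range (7 - 2 * l₀),
        ∫ x in Oset, ρ₀ x *
          (gradSq (pd1^[l₁] ((pdt^[l₀] v) t)) x + gradSq (pd1^[l₁ + 1] ((pdt^[l₀] v) t)) x) :=
    fun l₀ _ => Finset.sum_nonneg fun l₁ _ => en_t2 h0 l₀ l₁ t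
  have s2 := Finset.sum_nonneg s2'
  have s3'' : ∀ l₀ ∈ Finset.range 4, ∀ l₁ ∈ Finset.range (7 - 2 * l₀),
      0 ≤ ∑ l₂ ∈ Finset.Icc 2 (8 - 2 * l₀ - l₁),
          ∫ x in Oset, ρ₀ x ^ l₂ * ‖(pd1^[l₁] (pd2^[l₂] ((pdt^[l₀] v) t))) x‖ ^ 2 :=
    fun l₀ _ l₁ _ => Finset.sum_nonneg fun l₂ _ => en_t3 h0 l₀ l₁ l₂ t
  have s3' := fun l₀ h => Finset.sum_nonneg (s3'' l₀ h)
  have s3 := Finset.sum_nonneg s3'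
  refine ⟨?_, fun l hl => ?_, fun a b hb hab => ?_⟩
  · have := Finset.single_le_sum (fun l₀ _ => en_t1 h0 (v := v) l₀ t)
      (Finset.mem_range.2 (by norm_num : 0 < 5))
    simp only [Function.iterate_zero, id] at this
    unfold energy
    linarith
  · have h1 := Finset.single_le_sum s2' (Finset.mem_range.2 (by norm_num : 0 < 4))
    have h2 := Finset.single_le_sum (fun l₁ _ => en_t2 h0 (v := v) 0 l₁ t)
      (Finset.mem_range.2 (by omega : l < 7 - 2 * 0))
    simp only [Function.iterate_zero, id] at h1 h2
    unfold energy
    linarith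
  · have h1 := Finset.single_le_sum s3' (Finset.mem_range.2 (by norm_num : 0 < 4))
    have h2 := Finset.single_le_sum (s3'' 0 (Finset.mem_range.2 (by norm_num)))
      (Finset.mem_range.2 (by omega : a < 7 - 2 * 0))
    have h3 := Finset.single_le_sum (fun l₂ _ => en_t3 h0 (v := v) 0 a l₂ t)
      (Finset.mem_Icc.2 ⟨hb, (by omega : b ≤ 8 - 2 * 0 - a)⟩)
    simp only [Function.iterate_zero, id] at h1 h2 h3
    unfold energy
    linarith

lemma energy_ge (hρ : Continuous ρ₀) (h0 : ∀ x ∈ Oset, 0 ≤ ρ₀ x) (hv : SmoothT v) (t : ℝ)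
    (a b : ℕ) (ha : a ≤ 7) (hab : a + b ≤ 8) :
    ∫ x in Oset, ρ₀ x ^ (max b 1) * ‖pd1^[a] (pd2^[b] (v t)) x‖ ^ 2 ≤ energy ρ₀ v t := by
  obtain ⟨e1, e2, e3⟩ := energy_parts (v := v) h0 t
  have hs := hv.slice t
  have hgc : ∀ l, Continuous (gradSq (pd1^[l] (v t))) := fun l => by
    have h1 := (hs.pd1_iter l).pd1.cont
    have h2 := (hs.pd1_iter l).pd2.cont
    unfold gradSq
    fun_prop
  rcases Nat.lt_or_ge b 2 with hb | hb
  · have hm : max b 1 = 1 := by omega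
    rw [hm]
    simp only [pow_one]
    have hc := ((hs.pd2_iter b).pd1_iter a).cont
    -- reduce to a gradient term
    have red : ∀ l ≤ 6, (∀ x, ‖pd1^[a] (pd2^[b] (v t)) x‖ ^ 2 ≤
        gradSq (pd1^[l] (v t)) x + gradSq (pd1^[l + 1] (v t)) x) →
        ∫ x in Oset, ρ₀ x * ‖pd1^[a] (pd2^[b] (v t)) x‖ ^ 2 ≤ energy ρ₀ v t := by
      intro l hl h
      refine le_trans ?_ (e2 l hl)
      have h1 := hgc l
      have h2 := hgc (l + 1)
      refine setIntegral_mono_on (Oset_int (by fun_prop)) (Oset_int (by fun_prop)) Oset_meas ?_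
      intro x hx
      exact mul_le_mul_of_nonneg_left (h x) (h0 x hx)
    have gn : ∀ l x, 0 ≤ gradSq (pd1^[l] (v t)) x := fun l x => by unfold gradSq; positivity
    interval_cases b
    · cases a with
      | zero => simpa using e1
      | succ l =>
        refine red l (by omega) fun x => ?_
        have : ‖pd1^[l + 1] (pd2^[0] (v t)) x‖ ^ 2 ≤ gradSq (pd1^[l] (v t)) x := by
          rw [Function.iterate_succ_apply', Function.iterate_zero, id]
          exact le_add_of_nonneg_right (by positivity)
        linarith [gn (l + 1) x]
    · have e : pd1^[a] (pd2^[1] (v t)) = pd2 (pd1^[a] (v t)) := by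
        rw [pd2_pd1_iter hs, Function.iterate_one]
      have le : ∀ x, ‖pd1^[a] (pd2^[1] (v t)) x‖ ^ 2 ≤ gradSq (pd1^[a] (v t)) x := fun x => by
        rw [e]
        exact le_add_of_nonneg_left (by positivity)
      rcases Nat.lt_or_ge a 7 with h7 | h7
      · exact red a (by omega) fun x => by linarith [gn (a + 1) x, le x]
      · have : a = 6 + 1 := by omega
        subst this
        exact red 6 le_rfl fun x => by linarith [gn 6 x, le x]
  · rw [max_eq_left (by omega)]
    exact e3 a b hb hab

lemma core (C₁ C₂ : ℝ) (hC₁ : 0 < C₁) (hC₁₂ : C₁ ≤ C₂) (p a b : ℕ) (h1 : a + b ≤ 6)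
    (h2 : a + 2 * b ≤ 5 + 2 * p) :
    ∃ K : ℝ, 0 ≤ K ∧ ∀ ρ₀ : ℝ × ℝ → ℝ, IsDensity C₁ C₂ ρ₀ → ∀ v : ℝ → ℝ × ℝ → ℝ × ℝ,
      SmoothT v → ∀ t : ℝ, ∀ x ∈ Oset,
        ρ₀ x ^ p * ‖pd1^[a] (pd2^[b] (v t)) x‖ ≤ K * Real.sqrt (energy ρ₀ v t) := by
  set m := 6 - a - b with hm
  obtain ⟨C, hC, hT⟩ := twoD (H := ℝ × ℝ) p m
  set c : ℝ := max 1 C₁⁻¹ with hc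
  have hc1 : 1 ≤ c := le_max_left _ _
  have hC₂ : 0 ≤ C₂ := hC₁.le.trans hC₁₂
  refine ⟨C₂ ^ p * (C * (2 * ((m + 2 : ℕ) * Real.sqrt (c ^ 8)))), by positivity,
    fun ρ₀ hρ v hv t x hx => ?_⟩
  have h0 : ∀ x ∈ Oset, 0 ≤ ρ₀ x := fun x hx => rho_nonneg hC₁ hρ hx
  have hs := hv.slice t
  have hf := (hs.pd2_iter b).pd1_iter a
  have hρc : Continuous ρ₀ := hρ.1.cont
  have key := hT _ hf x hx
  have term : ∀ i ∈ Finset.range 2, ∀ j ∈ Finset.range (m + 2),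
      ∫ z in Oset, z.2 ^ (p + m) * (1 - z.2) ^ (p + m) *
        ‖pd1^[i] (pd2^[j] (pd1^[a] (pd2^[b] (v t)))) z‖ ≤
        Real.sqrt (c ^ 8) * Real.sqrt (energy ρ₀ v t) := by
    intro i hi j hj
    rw [Finset.mem_range] at hi hj
    rw [pd_mix hs]
    have hcont := ((hs.pd2_iter (j + b)).pd1_iter (i + a)).cont
    refine (Oset_cs (by fun_prop)).trans ?_
    rw [← Real.sqrt_mul (by positivity)]
    apply Real.sqrt_le_sqrt
    have hE := energy_ge hρc h0 hv t (i + a) (j + b) (by omega) (by omega)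
    refine le_trans ?_ (mul_le_mul_of_nonneg_left hE (by positivity))
    rw [← integral_const_mul]
    refine setIntegral_mono_on (Oset_int (by fun_prop)) (Oset_int (by fun_prop)) Oset_meas ?_
    intro z hz
    set w := max (j + b) 1 with hw
    have hz0 := hz.2.1
    have hz1 : 0 < 1 - z.2 := by linarith [hz.2.2]
    have hd : z.2 * (1 - z.2) ≤ distG z := by
      apply le_min
      · nlinarith
      · nlinarith
    have hd1 : z.2 * (1 - z.2) ≤ 1 := by nlinarith
    have hdr : distG z ≤ c * ρ₀ z := by
      have h3 := (hρ.2.2.2 z hz).1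
      have h4 : distG z ≤ C₁⁻¹ * ρ₀ z := by
        rw [← div_eq_inv_mul, le_div_iff₀ hC₁]; linarith
      exact h4.trans (mul_le_mul_of_nonneg_right (le_max_right _ _) (h0 z hz))
    have hdz := (distG_pos hz).le
    have hρz := h0 z hz
    have hpos : 0 ≤ z.2 * (1 - z.2) := by positivity
    have chain : (z.2 * (1 - z.2)) ^ (2 * (p + m)) ≤ c ^ 8 * ρ₀ z ^ w := by
      calc (z.2 * (1 - z.2)) ^ (2 * (p + m)) ≤ (z.2 * (1 - z.2)) ^ w :=
            pow_le_pow_of_le_one hpos hd1 (by omega)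
        _ ≤ (c * ρ₀ z) ^ w := pow_le_pow_left₀ hpos (hd.trans hdr) w
        _ = c ^ w * ρ₀ z ^ w := mul_pow _ _ _
        _ ≤ c ^ 8 * ρ₀ z ^ w := by
            have : c ^ w ≤ c ^ 8 := pow_le_pow_right₀ hc1 (by omega)
            gcongr
    rw [← mul_pow z.2, mul_pow _ ‖_‖, ← pow_mul, mul_comm (p + m) 2, ← mul_assoc]
    exact mul_le_mul_of_nonneg_right chain (by positivity)
  have hsum : ∑ i ∈ Finset.range 2, ∑ j ∈ Finset.range (m + 2),
      ∫ z in Oset, z.2 ^ (p + m) * (1 - z.2) ^ (p + m) *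
        ‖pd1^[i] (pd2^[j] (pd1^[a] (pd2^[b] (v t)))) z‖ ≤
      2 * ((m + 2 : ℕ) * (Real.sqrt (c ^ 8) * Real.sqrt (energy ρ₀ v t))) := by
    refine (Finset.sum_le_sum fun i hi => Finset.sum_le_sum (term i hi)).trans (le_of_eq ?_)
    simp
  have hd := (distG_pos hx).le
  have hρd : ρ₀ x ^ p ≤ C₂ ^ p * distG x ^ p := by
    rw [← mul_pow]
    exact pow_le_pow_left₀ (h0 x hx) (hρ.2.2.2 x hx).2 p
  calc ρ₀ x ^ p * ‖pd1^[a] (pd2^[b] (v t)) x‖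
      ≤ C₂ ^ p * distG x ^ p * ‖pd1^[a] (pd2^[b] (v t)) x‖ :=
        mul_le_mul_of_nonneg_right hρd (norm_nonneg _)
    _ = C₂ ^ p * (distG x ^ p * ‖pd1^[a] (pd2^[b] (v t)) x‖) := by ring
    _ ≤ C₂ ^ p * (C * (2 * ((m + 2 : ℕ) * (Real.sqrt (c ^ 8) * Real.sqrt (energy ρ₀ v t))))) :=
        mul_le_mul_of_nonneg_left (key.trans (mul_le_mul_of_nonneg_left hsum hC)) (by positivity)
    _ = _ := by ring

/-- Uniform version of `core`. -/
lemma core_unif (C₁ C₂ : ℝ) (hC₁ : 0 < C₁) (hC₁₂ : C₁ ≤ C₂) :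
    ∃ K : ℝ, 0 ≤ K ∧ ∀ p a b : ℕ, p ≤ 4 → a + b ≤ 6 → a + 2 * b ≤ 5 + 2 * p →
      ∀ ρ₀ : ℝ × ℝ → ℝ, IsDensity C₁ C₂ ρ₀ → ∀ v : ℝ → ℝ × ℝ → ℝ × ℝ,
      SmoothT v → ∀ t : ℝ, ∀ x ∈ Oset,
        ρ₀ x ^ p * ‖pd1^[a] (pd2^[b] (v t)) x‖ ≤ K * Real.sqrt (energy ρ₀ v t) := by
  have h : ∀ q : ℕ × ℕ × ℕ, ∃ K : ℝ, 0 ≤ K ∧ (q.2.1 + q.2.2 ≤ 6 →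
      q.2.1 + 2 * q.2.2 ≤ 5 + 2 * q.1 →
      ∀ ρ₀ : ℝ × ℝ → ℝ, IsDensity C₁ C₂ ρ₀ → ∀ v : ℝ → ℝ × ℝ → ℝ × ℝ,
      SmoothT v → ∀ t : ℝ, ∀ x ∈ Oset,
        ρ₀ x ^ q.1 * ‖pd1^[q.2.1] (pd2^[q.2.2] (v t)) x‖ ≤ K * Real.sqrt (energy ρ₀ v t)) := by
    intro q
    by_cases hq : q.2.1 + q.2.2 ≤ 6 ∧ q.2.1 + 2 * q.2.2 ≤ 5 + 2 * q.1
    · obtain ⟨K, hK, h⟩ := core C₁ C₂ hC₁ hC₁₂ q.1 q.2.1 q.2.2 hq.1 hq.2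
      exact ⟨K, hK, fun _ _ => h⟩
    · exact ⟨0, le_rfl, fun h1 h2 => absurd ⟨h1, h2⟩ hq⟩
  choose K hK h using h
  set S := Finset.range 5 ×ˢ Finset.range 7 ×ˢ Finset.range 7
  refine ⟨∑ q ∈ S, K q, Finset.sum_nonneg fun q _ => hK q, ?_⟩
  intro p a b hp h1 h2 ρ₀ hρ v hv t x hx
  refine (h (p, a, b) h1 h2 ρ₀ hρ v hv t x hx).trans ?_
  refine mul_le_mul_of_nonneg_right ?_ (Real.sqrt_nonneg _)
  refine Finset.single_le_sum (fun q _ => hK q) ?_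
  simp only [S, Finset.mem_product, Finset.mem_range]
  omega

end Core

section Flow

variable {v : ℝ → ℝ × ℝ → ℝ × ℝ}

/-- Time integral of a family. -/
def IV (v : ℝ → ℝ × ℝ → ℝ × ℝ) (t : ℝ) (x : ℝ × ℝ) : ℝ × ℝ := ∫ s in (0:ℝ)..t, v s x

lemma SmoothT.fderiv_cont (hv : SmoothT v) :
    Continuous (fun p : ℝ × (ℝ × ℝ) => fderiv ℝ (v p.1) p.2) := by
  have h1 := hv.pd1.cont
  have h2 := hv.pd2.cont
  have e : (fun p : ℝ × (ℝ × ℝ) => fderiv ℝ (v p.1) p.2) = fun p =>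
      ContinuousLinearMap.smulRightL ℝ (ℝ × ℝ) (ℝ × ℝ)
        (ContinuousLinearMap.fst ℝ ℝ ℝ) (_root_.pd1 (v p.1) p.2) +
      ContinuousLinearMap.smulRightL ℝ (ℝ × ℝ) (ℝ × ℝ)
        (ContinuousLinearMap.snd ℝ ℝ ℝ) (_root_.pd2 (v p.1) p.2) := by
    funext p
    exact congrFun (fderiv_decomp (v p.1)) p.2
  rw [e]
  exact ((ContinuousLinearMap.continuous _).comp h1).add
    ((ContinuousLinearMap.continuous _).comp h2)

lemma IV_hasFDerivAt (hv : SmoothT v) (t : ℝ) (x₀ : ℝ × ℝ) :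
    HasFDerivAt (IV v t) (∫ s in (0:ℝ)..t, fderiv ℝ (v s) x₀) x₀ := by
  have hc := hv.cont
  have hd := hv.fderiv_cont
  obtain ⟨B, hB⟩ := ((isCompact_uIcc (a := (0:ℝ)) (b := t)).prod
    (isCompact_closedBall x₀ 1)).exists_bound_of_continuousOn hd.continuousOn
  refine intervalIntegral.hasFDerivAt_integral_of_dominated_of_fderiv_le
    (F := fun x s => v s x) (F' := fun x s => fderiv ℝ (v s) x) (bound := fun _ => B)
    (Metric.closedBall_mem_nhds x₀ one_pos) ?_ ?_ ?_ ?_ ?_ ?_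
  · refine Eventually.of_forall fun x => ?_
    exact (hc.comp (by fun_prop : Continuous fun s : ℝ => (s, x))).aestronglyMeasurable
  · exact (hc.comp (by fun_prop : Continuous fun s : ℝ => (s, x₀))).intervalIntegrable _ _
  · exact (hd.comp (by fun_prop : Continuous fun s : ℝ => (s, x₀))).aestronglyMeasurable
  · refine Eventually.of_forall fun s hs x hx => ?_
    exact hB (s, x) ⟨Set.uIoc_subset_uIcc hs, hx⟩
  · exact intervalIntegrable_const
  · exact Eventually.of_forall fun s _ x _ => ((hv.slice s).diff x).hasFDerivAt

lemma IV_fderiv_apply (hv : SmoothT v) (t : ℝ) (e : ℝ × ℝ) (x : ℝ × ℝ) :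
    fderiv ℝ (IV v t) x e = ∫ s in (0:ℝ)..t, fderiv ℝ (v s) x e := by
  rw [(IV_hasFDerivAt hv t x).fderiv]
  refine ContinuousLinearMap.intervalIntegral_apply ?_ e
  exact (hv.fderiv_cont.comp (by fun_prop : Continuous fun s : ℝ => (s, x))).intervalIntegrable _ _

lemma IV_pd1 (hv : SmoothT v) (t : ℝ) : pd1 (IV v t) = IV (fun s => pd1 (v s)) t :=
  funext fun x => IV_fderiv_apply hv t _ x

lemma IV_pd2 (hv : SmoothT v) (t : ℝ) : pd2 (IV v t) = IV (fun s => pd2 (v s)) t :=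
  funext fun x => IV_fderiv_apply hv t _ x

lemma IV_smooth (t : ℝ) (n : ℕ) : ∀ {v : ℝ → ℝ × ℝ → ℝ × ℝ}, SmoothT v →
    ContDiff ℝ n (IV v t) := by
  induction n with
  | zero =>
    intro v hv
    rw [Nat.cast_zero, contDiff_zero]
    exact continuous_iff_continuousAt.2 fun x => (IV_hasFDerivAt hv t x).continuousAt
  | succ n ih =>
    intro v hv
    rw [Nat.cast_succ, contDiff_succ_iff_fderiv]
    refine ⟨fun x => (IV_hasFDerivAt hv t x).differentiableAt, by simp, ?_⟩
    rw [fderiv_decomp, IV_pd1 hv, IV_pd2 hv]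
    exact ((ContinuousLinearMap.contDiff _).comp (ih hv.pd1)).add
      ((ContinuousLinearMap.contDiff _).comp (ih hv.pd2))

lemma IV_smoothFn (hv : SmoothT v) (t : ℝ) : SmoothFn (IV v t) := fun n => IV_smooth t n hv

lemma IV_pd2_iter (hv : SmoothT v) (t : ℝ) (n : ℕ) :
    pd2^[n] (IV v t) = IV (fun s => pd2^[n] (v s)) t := by
  induction n with
  | zero => rfl
  | succ n ih =>
    simp only [Function.iterate_succ_apply']
    rw [ih, IV_pd2 (hv.pd2_iter n)]

lemma IV_pd1_iter (hv : SmoothT v) (t : ℝ) (n : ℕ) :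
    pd1^[n] (IV v t) = IV (fun s => pd1^[n] (v s)) t := by
  induction n with
  | zero => rfl
  | succ n ih =>
    simp only [Function.iterate_succ_apply']
    rw [ih, IV_pd1 (hv.pd1_iter n)]

lemma pd1_add {f g : ℝ × ℝ → ℝ × ℝ} (hf : SmoothFn f) (hg : SmoothFn g) :
    pd1 (f + g) = pd1 f + pd1 g := by
  funext x
  simp only [pd1, Pi.add_apply]
  rw [fderiv_add (hf.diff x) (hg.diff x)]
  rfl

lemma pd2_add {f g : ℝ × ℝ → ℝ × ℝ} (hf : SmoothFn f) (hg : SmoothFn g) :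
    pd2 (f + g) = pd2 f + pd2 g := by
  funext x
  simp only [pd2, Pi.add_apply]
  rw [fderiv_add (hf.diff x) (hg.diff x)]
  rfl

lemma pd1_iter_add {f g : ℝ × ℝ → ℝ × ℝ} (hf : SmoothFn f) (hg : SmoothFn g) (n : ℕ) :
    pd1^[n] (f + g) = pd1^[n] f + pd1^[n] g := by
  induction n with
  | zero => rfl
  | succ n ih =>
    simp only [Function.iterate_succ_apply']
    rw [ih, pd1_add (hf.pd1_iter n) (hg.pd1_iter n)]

lemma pd2_iter_add {f g : ℝ × ℝ → ℝ × ℝ} (hf : SmoothFn f) (hg : SmoothFn g) (n : ℕ) :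
    pd2^[n] (f + g) = pd2^[n] f + pd2^[n] g := by
  induction n with
  | zero => rfl
  | succ n ih =>
    simp only [Function.iterate_succ_apply']
    rw [ih, pd2_add (hf.pd2_iter n) (hg.pd2_iter n)]

lemma pd1_const (c : ℝ × ℝ) : pd1 (fun _ : ℝ × ℝ => c) = fun _ => 0 := by
  funext x; simp [pd1]

lemma pd2_const (c : ℝ × ℝ) : pd2 (fun _ : ℝ × ℝ => c) = fun _ => 0 := by
  funext x; simp [pd2]

lemma pd1_id : pd1 (fun x : ℝ × ℝ => x) = fun _ => (1, 0) := by
  funext x; simp [pd1]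

lemma pd2_id : pd2 (fun x : ℝ × ℝ => x) = fun _ => (0, 1) := by
  funext x; simp [pd2]

lemma pd1_iter_zero (n : ℕ) :
    pd1^[n] (fun _ : ℝ × ℝ => (0 : ℝ × ℝ)) = fun _ => 0 := by
  induction n with
  | zero => rfl
  | succ n ih => rw [Function.iterate_succ_apply', ih, pd1_const]

lemma pd2_iter_zero (n : ℕ) :
    pd2^[n] (fun _ : ℝ × ℝ => (0 : ℝ × ℝ)) = fun _ => 0 := by
  induction n with
  | zero => rfl
  | succ n ih => rw [Function.iterate_succ_apply', ih, pd2_const]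

lemma pd_id_zero (a b : ℕ) (h : 2 ≤ a + b) :
    pd1^[a] (pd2^[b] (fun x : ℝ × ℝ => x)) = fun _ => 0 := by
  match b, h with
  | 0, h =>
    obtain ⟨c, rfl⟩ : ∃ c, a = c + 1 + 1 := ⟨a - 2, by omega⟩
    rw [Function.iterate_zero, id, Function.iterate_succ_apply, Function.iterate_succ_apply,
      pd1_id, pd1_const, pd1_iter_zero]
  | 1, h =>
    obtain ⟨c, rfl⟩ : ∃ c, a = c + 1 := ⟨a - 1, by omega⟩
    rw [Function.iterate_one, Function.iterate_succ_apply, pd2_id, pd1_const, pd1_iter_zero]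
  | b + 2, h =>
    rw [Function.iterate_succ_apply, Function.iterate_succ_apply,
      pd2_id, pd2_const, pd2_iter_zero, pd1_iter_zero]

lemma pd_id_one (a b : ℕ) (h : a + b = 1) (x : ℝ × ℝ) :
    ‖pd1^[a] (pd2^[b] (fun x : ℝ × ℝ => x)) x‖ ≤ 1 := by
  obtain ⟨rfl, rfl⟩ | ⟨rfl, rfl⟩ : (a = 0 ∧ b = 1) ∨ (a = 1 ∧ b = 0) := by omega
  · simp [pd2_id]
  · simp [pd1_id]

lemma id_smooth : SmoothFn (fun x : ℝ × ℝ => x) := fun _ => contDiff_id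

lemma flow_eq (v : ℝ → ℝ × ℝ → ℝ × ℝ) (t : ℝ) :
    flowMap v t = (fun x : ℝ × ℝ => x) + IV v t := rfl

lemma flow_smooth (hv : SmoothT v) (t : ℝ) : SmoothFn (flowMap v t) := by
  intro n
  rw [flow_eq]
  exact (id_smooth n).add (IV_smoothFn hv t n)

lemma flow_pd (hv : SmoothT v) (t : ℝ) (a b : ℕ) (x : ℝ × ℝ) :
    pd1^[a] (pd2^[b] (flowMap v t)) x = pd1^[a] (pd2^[b] (fun x : ℝ × ℝ => x)) x +
      ∫ s in (0:ℝ)..t, pd1^[a] (pd2^[b] (v s)) x := by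
  rw [flow_eq, pd2_iter_add id_smooth (IV_smoothFn hv t),
    pd1_iter_add (id_smooth.pd2_iter b) ((IV_smoothFn hv t).pd2_iter b),
    IV_pd2_iter hv, IV_pd1_iter (hv.pd2_iter b)]
  rfl

lemma supEn_ge {ρ₀ : ℝ × ℝ → ℝ} (hρ : Continuous ρ₀) (hv : SmoothT v) {s t : ℝ}
    (hs : s ∈ Set.Icc 0 t) : Real.sqrt (energy ρ₀ v s) ≤ supEn ρ₀ v t := by
  have hc : Continuous fun s => Real.sqrt (energy ρ₀ v s) := (energy_cont hρ hv).sqrt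
  have hb : BddAbove (Set.range fun s : Set.Icc (0:ℝ) t => Real.sqrt (energy ρ₀ v s)) := by
    have := (isCompact_Icc (a := (0:ℝ)) (b := t)).bddAbove_image hc.continuousOn
    refine this.mono ?_
    rintro _ ⟨s, rfl⟩
    exact ⟨s, s.2, rfl⟩
  exact le_ciSup hb ⟨s, hs⟩

lemma wSup_le {ρ₀ : ℝ × ℝ → ℝ} (h0 : ∀ x ∈ Oset, 0 ≤ ρ₀ x) {f : ℝ × ℝ → ℝ × ℝ}
    (hf : SmoothFn f) (p k l : ℕ) (hk : k ≤ 6) (B : ℝ) (hB : 0 ≤ B)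
    (h : ∀ x ∈ Oset, ∀ i j, i + j = k → ρ₀ x ^ p * ‖pd1^[i + l] (pd2^[j] f) x‖ ≤ B) :
    wSup ρ₀ p k l f ≤ 64 * B := by
  have := Oset_nonempty
  refine ciSup_le fun x => ?_
  have hx := h x x.2
  have hr : 0 ≤ ρ₀ x ^ p := pow_nonneg (h0 x x.2) p
  have key : ρ₀ x ^ p * ‖iteratedFDeriv ℝ k (pd1^[l] f) x‖ ≤ 2 ^ k * B := by
    rcases hr.eq_or_lt with h0 | hpos
    · rw [← h0, zero_mul]; positivity
    · have := iter_bound k (hf.pd1_iter l) x (B / ρ₀ x ^ p) (fun i j hij => by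
        rw [le_div_iff₀ hpos, pd2_iter_pd1_iter hf, ← Function.iterate_add_apply, mul_comm]
        exact hx i j hij)
      calc _ ≤ ρ₀ x ^ p * (2 ^ k * (B / ρ₀ x ^ p)) := mul_le_mul_of_nonneg_left this hr
        _ = _ := by field_simp
  refine key.trans (mul_le_mul_of_nonneg_right ?_ hB)
  calc (2:ℝ) ^ k ≤ 2 ^ 6 := pow_le_pow_right₀ (by norm_num) hk
    _ = 64 := by norm_num

end Flow

/-- (Weighted `L^∞` estimates, Corollary 3.3.)
All the listed weighted `L^∞(Ω)` norms of `v(t)` are bounded by `C E(t,v)^{1/2}`;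
`‖Dη(t)‖_{L^∞} ≤ C(1 + t sup_{0≤s≤t}E(s,v)^{1/2})` and the remaining listed weighted
`L^∞` norms of `η(t)` are bounded by `C t sup_{0≤s≤t}E(s,v)^{1/2}`. -/
theorem stmt2 (C₁ C₂ : ℝ) (hC₁ : 0 < C₁) (hC₁₂ : C₁ ≤ C₂) :
    ∃ C > (0:ℝ),
      ∀ ρ₀ : ℝ × ℝ → ℝ, IsDensity C₁ C₂ ρ₀ →
        ∀ T : ℝ, 0 ≤ T →
          ∀ v : ℝ → ℝ × ℝ → ℝ × ℝ, SmoothT v → PerT v →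
            ∀ t ∈ Set.Icc (0:ℝ) T,
              ((∑ l₂ ∈ Finset.range 2,
                      ((∑ l₁ ∈ Finset.range 5, wSup ρ₀ l₂ l₂ l₁ (v t))
                        + ∑ l₁ ∈ Finset.range 3, wSup ρ₀ l₂ (l₂ + 1) l₁ (v t)))
                    + (∑ l₁ ∈ Finset.range 3, wSup ρ₀ 3 4 l₁ (v t))
                    + (∑ l₂ ∈ Finset.Icc 1 4, wSup ρ₀ l₂ (l₂ + 2) 0 (v t))
                  ≤ C * Real.sqrt (energy ρ₀ v t)) ∧
              (wSup ρ₀ 0 1 0 (flowMap v t) ≤ C * (1 + t * supEn ρ₀ v t)) ∧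
              ((∑ l₁ ∈ Finset.Icc 2 4, wSup ρ₀ 0 0 l₁ (flowMap v t))
                    + (∑ l₁ ∈ Finset.Icc 1 2, wSup ρ₀ 0 1 l₁ (flowMap v t))
                    + (∑ l₁ ∈ Finset.Icc 1 4, wSup ρ₀ 1 1 l₁ (flowMap v t))
                    + (∑ l₁ ∈ Finset.range 3, wSup ρ₀ 1 2 l₁ (flowMap v t))
                    + (∑ l₁ ∈ Finset.range 3, wSup ρ₀ 3 4 l₁ (flowMap v t))
                    + (∑ l₂ ∈ Finset.Icc 1 4, wSup ρ₀ l₂ (l₂ + 2) 0 (flowMap v t))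
                  ≤ C * t * supEn ρ₀ v t) := by
  obtain ⟨K, hK, hcore⟩ := core_unif C₁ C₂ hC₁ hC₁₂
  refine ⟨64 * 23 * (K + 1), by positivity, ?_⟩
  intro ρ₀ hρ T _ v hv _ t ht
  have h0 : ∀ x ∈ Oset, 0 ≤ ρ₀ x := fun x hx => rho_nonneg hC₁ hρ hx
  have hρc : Continuous ρ₀ := hρ.1.cont
  have hE : 0 ≤ Real.sqrt (energy ρ₀ v t) := Real.sqrt_nonneg _
  have hsE : 0 ≤ supEn ρ₀ v t := hE.trans (supEn_ge hρc hv ⟨ht.1, le_rfl⟩)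
  have htE : 0 ≤ t * supEn ρ₀ v t := mul_nonneg ht.1 hsE
  have hKE := mul_nonneg hK hE
  have hKt := mul_nonneg hK htE
  have V : ∀ p k l : ℕ, p ≤ 4 → k + l ≤ 6 → l + 2 * k ≤ 5 + 2 * p →
      wSup ρ₀ p k l (v t) ≤ 64 * (K * Real.sqrt (energy ρ₀ v t)) := by
    intro p k l hp h1 h2
    refine wSup_le h0 (hv.slice t) p k l (by omega) _ hKE fun x hx i j hij => ?_
    exact hcore p (i + l) j hp (by omega) (by omega) ρ₀ hρ v hv t x hx
  have W : ∀ p a b : ℕ, p ≤ 4 → a + b ≤ 6 → a + 2 * b ≤ 5 + 2 * p → ∀ x ∈ Oset,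
      ρ₀ x ^ p * ‖∫ s in (0:ℝ)..t, pd1^[a] (pd2^[b] (v s)) x‖ ≤ K * (t * supEn ρ₀ v t) := by
    intro p a b hp h1 h2 x hx
    have hr : 0 ≤ ρ₀ x ^ p := pow_nonneg (h0 x hx) p
    have e : ρ₀ x ^ p * ‖∫ s in (0:ℝ)..t, pd1^[a] (pd2^[b] (v s)) x‖ =
        ‖∫ s in (0:ℝ)..t, ρ₀ x ^ p • pd1^[a] (pd2^[b] (v s)) x‖ := by
      rw [intervalIntegral.integral_smul, norm_smul, Real.norm_of_nonneg hr]
    rw [e]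
    have := intervalIntegral.norm_integral_le_of_norm_le_const (a := (0:ℝ)) (b := t)
      (f := fun s => ρ₀ x ^ p • pd1^[a] (pd2^[b] (v s)) x) (C := K * supEn ρ₀ v t) (by
        intro s hs
        rw [Set.uIoc_of_le ht.1] at hs
        rw [norm_smul, Real.norm_of_nonneg hr]
        refine (hcore p a b hp h1 h2 ρ₀ hρ v hv s x hx).trans ?_
        exact mul_le_mul_of_nonneg_left (supEn_ge hρc hv ⟨hs.1.le, hs.2⟩) hK)
    rw [sub_zero, abs_of_nonneg ht.1] at this
    linarith
  have Fl : ∀ p k l : ℕ, p ≤ 4 → k + l ≤ 6 → 2 ≤ k + l → l + 2 * k ≤ 5 + 2 * p →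
      wSup ρ₀ p k l (flowMap v t) ≤ 64 * (K * (t * supEn ρ₀ v t)) := by
    intro p k l hp h1 h3 h2
    refine wSup_le h0 (flow_smooth hv t) p k l (by omega) _ hKt fun x hx i j hij => ?_
    rw [flow_pd hv, pd_id_zero _ _ (by omega), zero_add]
    exact W p (i + l) j hp (by omega) (by omega) x hx
  refine ⟨?_, ?_, ?_⟩
  · have hS : Finset.Icc 1 4 = ({1, 2, 3, 4} : Finset ℕ) := by decide
    simp only [hS, Finset.sum_range_succ, Finset.sum_range_zero, zero_add]
    rw [Finset.sum_insert (by decide), Finset.sum_insert (by decide),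
      Finset.sum_insert (by decide), Finset.sum_singleton]
    norm_num only
    have a1 := V 0 0 0 (by omega) (by omega) (by omega)
    have a2 := V 0 0 1 (by omega) (by omega) (by omega)
    have a3 := V 0 0 2 (by omega) (by omega) (by omega)
    have a4 := V 0 0 3 (by omega) (by omega) (by omega)
    have a5 := V 0 0 4 (by omega) (by omega) (by omega)
    have a6 := V 0 1 0 (by omega) (by omega) (by omega)
    have a7 := V 0 1 1 (by omega) (by omega) (by omega)
    have a8 := V 0 1 2 (by omega) (by omega) (by omega)
    have b1 := V 1 1 0 (by omega) (by omega) (by omega)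
    have b2 := V 1 1 1 (by omega) (by omega) (by omega)
    have b3 := V 1 1 2 (by omega) (by omega) (by omega)
    have b4 := V 1 1 3 (by omega) (by omega) (by omega)
    have b5 := V 1 1 4 (by omega) (by omega) (by omega)
    have b6 := V 1 2 0 (by omega) (by omega) (by omega)
    have b7 := V 1 2 1 (by omega) (by omega) (by omega)
    have b8 := V 1 2 2 (by omega) (by omega) (by omega)
    have c1 := V 3 4 0 (by omega) (by omega) (by omega)
    have c2 := V 3 4 1 (by omega) (by omega) (by omega)
    have c3 := V 3 4 2 (by omega) (by omega) (by omega)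
    have d1 := V 1 3 0 (by omega) (by omega) (by omega)
    have d2 := V 2 4 0 (by omega) (by omega) (by omega)
    have d3 := V 3 5 0 (by omega) (by omega) (by omega)
    have d4 := V 4 6 0 (by omega) (by omega) (by omega)
    linarith
  · have h := wSup_le h0 (flow_smooth hv t) 0 1 0 (by omega) (1 + K * (t * supEn ρ₀ v t))
      (by positivity) (fun x hx i j hij => by
        rw [flow_pd hv, pow_zero, one_mul]
        refine (norm_add_le _ _).trans (add_le_add (pd_id_one _ _ (by omega) x) ?_)
        have := W 0 (i + 0) j (by omega) (by omega) (by omega) x hx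
        rwa [pow_zero, one_mul] at this)
    linarith
  · have hS : Finset.Icc 1 4 = ({1, 2, 3, 4} : Finset ℕ) := by decide
    have hS2 : Finset.Icc 2 4 = ({2, 3, 4} : Finset ℕ) := by decide
    have hS3 : Finset.Icc 1 2 = ({1, 2} : Finset ℕ) := by decide
    simp only [hS, hS2, hS3, Finset.sum_range_succ, Finset.sum_range_zero, zero_add]
    repeat rw [Finset.sum_insert (by decide)]
    simp only [Finset.sum_singleton]
    norm_num only
    have a1 := Fl 0 0 2 (by omega) (by omega) (by omega) (by omega)
    have a2 := Fl 0 0 3 (by omega) (by omega) (by omega) (by omega)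
    have a3 := Fl 0 0 4 (by omega) (by omega) (by omega) (by omega)
    have a4 := Fl 0 1 1 (by omega) (by omega) (by omega) (by omega)
    have a5 := Fl 0 1 2 (by omega) (by omega) (by omega) (by omega)
    have b1 := Fl 1 1 1 (by omega) (by omega) (by omega) (by omega)
    have b2 := Fl 1 1 2 (by omega) (by omega) (by omega) (by omega)
    have b3 := Fl 1 1 3 (by omega) (by omega) (by omega) (by omega)
    have b4 := Fl 1 1 4 (by omega) (by omega) (by omega) (by omega)
    have b5 := Fl 1 2 0 (by omega) (by omega) (by omega) (by omega)
    have b6 := Fl 1 2 1 (by omega) (by omega) (by omega) (by omega)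
    have b7 := Fl 1 2 2 (by omega) (by omega) (by omega) (by omega)
    have c1 := Fl 3 4 0 (by omega) (by omega) (by omega) (by omega)
    have c2 := Fl 3 4 1 (by omega) (by omega) (by omega) (by omega)
    have c3 := Fl 3 4 2 (by omega) (by omega) (by omega) (by omega)
    have d1 := Fl 1 3 0 (by omega) (by omega) (by omega) (by omega)
    have d2 := Fl 2 4 0 (by omega) (by omega) (by omega) (by omega)
    have d3 := Fl 3 5 0 (by omega) (by omega) (by omega) (by omega)
    have d4 := Fl 4 6 0 (by omega) (by omega) (by omega) (by omega)
    linarith
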